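/- For all positive integers n and d there exist vectors v_1, …, v_d ∈ ℝ^n such that the number of sign vectors ε ∈ {−1, 1}^n for which there exists x in the linear span of {v_1, …, v_d} with ε_i x_i > 0 for all i ∈ {1,…,n} is exactly 2 · ∑_{i=0}^{d−1} binom(n−1, i). In particular, the maximum number C(n,d) of open orthants of ℝ^n intersected by the span of d vectors equals 2 · ∑_{i=0}^{d−1} binom(n−1, i); for d = 1 this equals 2, and for d ≥ n this equals 2^n. -/

import Mathlib

open Finset

/-- The number of open orthants of `ℝ^n` (equivalently, full sign patterns)
properly intersected by the linear span of the vectors `v 0, …, v (d-1)`. -/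
noncomputable def orthantCount (n d : ℕ) (v : Fin d → (Fin n → ℝ)) : ℕ :=
  {ε : Fin n → ℝ | (∀ i, ε i = 1 ∨ ε i = -1) ∧
      ∃ x ∈ Submodule.span ℝ (Set.range v), ∀ i, 0 < ε i * x i}.ncard

/-- The number of subsets of an `m`-element type with fewer than `d` elements. -/
theorem card_filter_card_lt (m d : ℕ) :
    #{s : Finset (Fin m) | #s < d} = ∑ i ∈ Finset.range d, m.choose i := by
  rw [Finset.card_eq_sum_card_fiberwise (f := Finset.card) (t := Finset.range d)]
  · refine Finset.sum_congr rfl fun i hi => ?_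
    have h : {s ∈ ({s : Finset (Fin m) | #s < d} : Finset (Finset (Fin m))) | #s = i}
        = Finset.powersetCard i Finset.univ := by
      ext s
      have := Finset.mem_range.1 hi
      simp only [Finset.mem_filter, Finset.mem_univ, true_and, Finset.mem_powersetCard,
        Finset.subset_univ]
      lia
    rw [h, Finset.card_powersetCard, Finset.card_univ, Fintype.card_fin]
  · intro s hs
    simpa using hs

open Classical in
/-- The sign patterns of the vectors of `W` with positive first coordinate, each recorded as the
set of the remaining coordinates that are positive. -/
noncomputable def positivePatterns {m : ℕ} (W : Submodule ℝ (Fin (m + 1) → ℝ)) :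
    Finset (Finset (Fin m)) :=
  {s | ∃ x ∈ W, 0 < x 0 ∧ ∀ i, (i ∈ s → 0 < x i.succ) ∧ (i ∉ s → x i.succ < 0)}

theorem mem_positivePatterns {m : ℕ} {W : Submodule ℝ (Fin (m + 1) → ℝ)} {s : Finset (Fin m)} :
    s ∈ positivePatterns W ↔
      ∃ x ∈ W, 0 < x 0 ∧ ∀ i, (i ∈ s → 0 < x i.succ) ∧ (i ∉ s → x i.succ < 0) := by
  simp [positivePatterns]

/-- If the sign patterns with positive first coordinate shatter `s`, then no nontrivial linear
relation holds on the first coordinate together with those in `s`. -/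
theorem eq_zero_of_shatters {m : ℕ} {W : Submodule ℝ (Fin (m + 1) → ℝ)} {s : Finset (Fin m)}
    (hs : (positivePatterns W).Shatters s) {c : Option s → ℝ} (h0 : 0 ≤ c none)
    (hc : ∀ x ∈ W, c none * x 0 + ∑ i : s, c (some i) * x (i : Fin m).succ = 0) : c = 0 := by
  classical
  obtain ⟨u, hu, hut⟩ := hs (Finset.filter_subset (fun i => ∃ h : i ∈ s, 0 < c (some ⟨i, h⟩)) s)
  obtain ⟨x, hxW, hx0, hx⟩ := mem_positivePatterns.1 hu
  have key : ∀ i : s, 0 ≤ c (some i) * x (i : Fin m).succ ∧ x (i : Fin m).succ ≠ 0 := by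
    rintro ⟨i, hi⟩
    have hmem : i ∈ u ↔ 0 < c (some ⟨i, hi⟩) := by
      have := congrArg (i ∈ ·) hut
      simpa [hi] using this
    by_cases h : i ∈ u
    · have := (hx i).1 h
      exact ⟨(mul_pos (hmem.1 h) this).le, this.ne'⟩
    · have := (hx i).2 h
      exact ⟨mul_nonneg_of_nonpos_of_nonpos (not_lt.1 (mt hmem.2 h)) this.le, this.ne⟩
  have hsum := hc x hxW
  have hnn : 0 ≤ ∑ i : s, c (some i) * x (i : Fin m).succ :=
    Finset.sum_nonneg fun i _ => (key i).1
  have hnn0 : 0 ≤ c none * x 0 := mul_nonneg h0 hx0.le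
  have hzero := (Finset.sum_eq_zero_iff_of_nonneg fun i _ => (key i).1).1
    (show ∑ i : s, c (some i) * x (i : Fin m).succ = 0 by linarith)
  funext i
  cases i with
  | none => exact (mul_eq_zero.1 (show c none * x 0 = 0 by linarith)).resolve_right hx0.ne'
  | some i => exact (mul_eq_zero.1 (hzero i (Finset.mem_univ i))).resolve_right (key i).2

theorem card_lt_of_shatters {m d : ℕ} (v : Fin d → (Fin (m + 1) → ℝ)) {s : Finset (Fin m)}
    (hs : (positivePatterns (Submodule.span ℝ (Set.range v))).Shatters s) : #s < d := by
  by_contra! hd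
  let idx : Option s → Fin (m + 1) := fun o => o.elim 0 fun i => (i : Fin m).succ
  have hdep : ¬ LinearIndependent ℝ (fun o : Option s => fun k : Fin d => v k (idx o)) := by
    intro h
    have := h.fintype_card_le_finrank
    simp at this
    lia
  obtain ⟨c, hc, o, ho⟩ := Fintype.not_linearIndependent_iff.1 hdep
  have hrel : ∀ x ∈ Submodule.span ℝ (Set.range v), ∑ o, c o * x (idx o) = 0 := by
    intro x hx
    induction hx using Submodule.span_induction with
    | mem x hx =>
      obtain ⟨k, rfl⟩ := hx
      simpa using congrFun hc k
    | zero => simp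
    | add x y _ _ hx hy => simp [mul_add, Finset.sum_add_distrib, hx, hy]
    | smul a x _ hx =>
      simp only [Pi.smul_apply, smul_eq_mul, mul_left_comm _ a, ← Finset.mul_sum, hx, mul_zero]
  simp only [Fintype.sum_option] at hrel
  rcases le_total 0 (c none) with h | h
  · exact ho (congrFun (eq_zero_of_shatters hs h hrel) o)
  · have hneg : -c = 0 := by
      refine eq_zero_of_shatters hs (by simpa using h) fun x hx => ?_
      have := hrel x hx
      simp only [Pi.neg_apply, neg_mul, Finset.sum_neg_distrib]
      rw [← neg_add, neg_eq_zero]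
      exact this
    exact ho (congrFun (neg_eq_zero.1 hneg) o)

theorem card_positivePatterns_le {m d : ℕ} (v : Fin d → (Fin (m + 1) → ℝ)) :
    #(positivePatterns (Submodule.span ℝ (Set.range v))) ≤
      ∑ i ∈ Finset.range d, m.choose i := by
  rw [← card_filter_card_lt]
  refine (Finset.card_le_card_shatterer _).trans (Finset.card_le_card fun s hs => ?_)
  simpa using card_lt_of_shatters v (Finset.mem_shatterer.1 hs)

theorem finite_signVectors (n : ℕ) : {ε : Fin n → ℝ | ∀ i, ε i = 1 ∨ ε i = -1}.Finite := by
  have : {ε : Fin n → ℝ | ∀ i, ε i = 1 ∨ ε i = -1} = Set.pi Set.univ fun _ => {1, -1} := by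
    ext; simp
  rw [this]
  exact Set.Finite.pi fun _ => Set.toFinite {1, -1}

theorem orthantCount_le {m d : ℕ} (v : Fin d → (Fin (m + 1) → ℝ)) :
    orthantCount (m + 1) d v ≤ 2 * ∑ i ∈ Finset.range d, m.choose i := by
  classical
  refine le_trans ?_ (Nat.mul_le_mul_left 2 (card_positivePatterns_le v))
  set W := Submodule.span ℝ (Set.range v)
  have hcard : ((({1, -1} : Finset ℝ) ×ˢ positivePatterns W : Finset (ℝ × Finset (Fin m))) :
      Set (ℝ × Finset (Fin m))).ncard = 2 * #(positivePatterns W) := by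
    rw [Set.ncard_coe_finset, Finset.card_product, Finset.card_pair (by norm_num)]
  rw [← hcard]
  refine Set.ncard_le_ncard_of_injOn
    (fun ε => (ε 0, Finset.univ.filter fun i : Fin m => ε i.succ = ε 0)) ?_ ?_
    (Finset.finite_toSet _)
  · rintro ε ⟨hε, x, hx, hpos⟩
    simp only [Finset.coe_product, Set.mem_prod, Finset.mem_coe, mem_positivePatterns]
    refine ⟨by simpa using hε 0, ε 0 • x, W.smul_mem _ hx, hpos 0,
      fun i => ⟨fun h => ?_, fun h => ?_⟩⟩
    · have h' : ε i.succ = ε 0 := by simpa using h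
      simpa [← h'] using hpos i.succ
    · have h' : ε i.succ ≠ ε 0 := by simpa using h
      have hp := hpos i.succ
      have : ε 0 = - ε i.succ := by
        rcases hε 0 with h0 | h0 <;> rcases hε i.succ with h1 | h1 <;> simp_all
      simpa [this] using hp
  · rintro ε ⟨hε, -⟩ δ ⟨hδ, -⟩ h
    obtain ⟨h0, hs⟩ := Prod.mk.inj h
    funext i
    refine Fin.cases h0 (fun i => ?_) i
    have := congrArg (i ∈ ·) hs
    simp only [Finset.mem_filter, Finset.mem_univ, true_and, eq_iff_iff] at this
    rcases hε 0 with a | a <;> rcases hε i.succ with b | b <;> rcases hδ i.succ with e | e <;>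
      rw [← h0, a, b, e] at this <;> rw [b, e] <;> norm_num at this

/-- The sign vector with first entry `a` that changes sign exactly at the positions in `S`. -/
def signChangeVector {m : ℕ} (a : ℝ) (S : Finset (Fin m)) (i : Fin (m + 1)) : ℝ :=
  a * ∏ j ∈ S, if (i : ℕ) ≤ j then 1 else -1

theorem signChangeVector_zero {m : ℕ} (a : ℝ) (S : Finset (Fin m)) :
    signChangeVector a S 0 = a := by
  simp [signChangeVector]

theorem signChangeVector_succ {m : ℕ} (a : ℝ) (S : Finset (Fin m)) (i : Fin m) :
    signChangeVector a S i.succ = signChangeVector a S i.castSucc * if i ∈ S then -1 else 1 := by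
  have h : (if i ∈ S then -1 else 1 : ℝ) = ∏ j ∈ S, if j = i then -1 else 1 := by
    rw [Finset.prod_ite_eq']
  rw [h, signChangeVector, signChangeVector, mul_assoc, ← Finset.prod_mul_distrib]
  congr 1
  refine Finset.prod_congr rfl fun j _ => ?_
  simp only [Fin.val_succ, Fin.val_castSucc, Fin.ext_iff]
  split_ifs <;> lia

theorem signChangeVector_eq_one_or {m : ℕ} {a : ℝ} (ha : a = 1 ∨ a = -1) (S : Finset (Fin m))
    (i : Fin (m + 1)) : signChangeVector a S i = 1 ∨ signChangeVector a S i = -1 := by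
  induction i using Fin.induction with
  | zero => rwa [signChangeVector_zero]
  | succ i ih =>
    rw [signChangeVector_succ]
    split_ifs <;> rcases ih with h | h <;> simp [h]

theorem signChangeVector_injOn {m : ℕ} :
    Set.InjOn (fun p : ℝ × Finset (Fin m) => signChangeVector p.1 p.2)
      {p | p.1 = 1 ∨ p.1 = -1} := by
  rintro ⟨a, S⟩ ha ⟨b, T⟩ hb h
  have hi : ∀ i, signChangeVector a S i = signChangeVector b T i := congrFun h
  refine Prod.ext (by simpa [signChangeVector_zero] using hi 0) (Finset.ext fun i => ?_)
  have hs := hi i.succ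
  rw [signChangeVector_succ, signChangeVector_succ, hi i.castSucc] at hs
  have hne : signChangeVector b T i.castSucc ≠ 0 := by
    rcases signChangeVector_eq_one_or hb T i.castSucc with h | h <;> rw [h] <;> norm_num
  have := mul_left_cancel₀ hne hs
  by_cases h1 : i ∈ S <;> by_cases h2 : i ∈ T <;> simp [h1, h2] at this ⊢ <;> norm_num at this

/-- The vectors `(0 ^ k, 1 ^ k, …, (n - 1) ^ k)` for `k < d`. -/
def powerVectors (n d : ℕ) (k : Fin d) (i : Fin n) : ℝ := (i : ℝ) ^ (k : ℕ)

theorem eval_mem_span_powerVectors {n d : ℕ} {p : Polynomial ℝ} (hp : p.natDegree < d) :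
    (fun i : Fin n => p.eval (i : ℝ)) ∈ Submodule.span ℝ (Set.range (powerVectors n d)) := by
  have : (fun i : Fin n => p.eval (i : ℝ)) = ∑ k : Fin d, p.coeff k • powerVectors n d k := by
    funext i
    rw [Polynomial.eval_eq_sum_range' hp, Finset.sum_range]
    simp [powerVectors]
  rw [this]
  exact Submodule.sum_mem _ fun k _ =>
    Submodule.smul_mem _ _ (Submodule.subset_span (Set.mem_range_self k))

theorem exists_mem_span_powerVectors_pos {m d : ℕ} {a : ℝ} (ha : a = 1 ∨ a = -1)
    {S : Finset (Fin m)} (hS : #S < d) :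
    ∃ x ∈ Submodule.span ℝ (Set.range (powerVectors (m + 1) d)),
      ∀ i, 0 < signChangeVector a S i * x i := by
  let p : Polynomial ℝ :=
    Polynomial.C a * ∏ j ∈ S, (Polynomial.C ((j : ℝ) + 1 / 2) - Polynomial.X)
  have hdeg : p.natDegree < d := by
    refine lt_of_le_of_lt ((Polynomial.natDegree_C_mul_le _ _).trans
      ((Polynomial.natDegree_prod_le _ _).trans ?_)) hS
    rw [Finset.card_eq_sum_ones]
    refine Finset.sum_le_sum fun j _ => (Polynomial.natDegree_sub_le _ _).trans ?_
    simp
  refine ⟨_, eval_mem_span_powerVectors hdeg, fun i => ?_⟩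
  have haa : a * a = 1 := by rcases ha with rfl | rfl <;> norm_num
  simp only [p, signChangeVector, Polynomial.eval_mul, Polynomial.eval_prod, Polynomial.eval_sub,
    Polynomial.eval_C, Polynomial.eval_X]
  rw [mul_mul_mul_comm, haa, one_mul, ← Finset.prod_mul_distrib]
  refine Finset.prod_pos fun j _ => ?_
  split_ifs with h
  · have : (i : ℝ) ≤ j := by exact_mod_cast h
    linarith
  · have : (j : ℝ) + 1 ≤ i := by exact_mod_cast not_le.1 h
    linarith

theorem le_orthantCount_powerVectors (m d : ℕ) :
    2 * ∑ i ∈ Finset.range d, m.choose i ≤ orthantCount (m + 1) d (powerVectors (m + 1) d) := by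
  classical
  have hcard : ((({1, -1} : Finset ℝ) ×ˢ ({S : Finset (Fin m) | #S < d} : Finset _) :
      Finset (ℝ × Finset (Fin m))) : Set (ℝ × Finset (Fin m))).ncard =
        2 * ∑ i ∈ Finset.range d, m.choose i := by
    rw [Set.ncard_coe_finset, Finset.card_product, Finset.card_pair (by norm_num),
      card_filter_card_lt]
  rw [← hcard]
  refine Set.ncard_le_ncard_of_injOn (fun p => signChangeVector p.1 p.2) ?_
    (signChangeVector_injOn.mono ?_) ((finite_signVectors _).subset fun ε h => h.1)
  · rintro ⟨a, S⟩ h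
    have h : (a = 1 ∨ a = -1) ∧ #S < d := by simpa using h
    exact ⟨signChangeVector_eq_one_or h.1 S, exists_mem_span_powerVectors_pos h.1 h.2⟩
  · rintro ⟨a, S⟩ h
    have h : (a = 1 ∨ a = -1) ∧ #S < d := by simpa using h
    exact h.1

/-- The bound `2 * ∑_{i=0}^{d-1} C(n-1, i)` on the number of open orthants
intersected by the span of `d` vectors in `ℝ^n` is attained, so the maximum
`C(n,d)` equals `2 * ∑_{i=0}^{d-1} C(n-1, i)`; in particular it is `2` for
`d = 1` and `2^n` for `d ≥ n`. -/
theorem orthant_count_max_attained (n d : ℕ) (hn : 0 < n) (hd : 0 < d) :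
    (∃ v : Fin d → (Fin n → ℝ),
      orthantCount n d v = 2 * ∑ i ∈ Finset.range d, (n - 1).choose i) ∧
    (∀ v : Fin d → (Fin n → ℝ),
      orthantCount n d v ≤ 2 * ∑ i ∈ Finset.range d, (n - 1).choose i) ∧
    (d = 1 → 2 * ∑ i ∈ Finset.range d, (n - 1).choose i = 2) ∧
    (n ≤ d → 2 * ∑ i ∈ Finset.range d, (n - 1).choose i = 2 ^ n) := by
  obtain ⟨m, rfl⟩ : ∃ m, n = m + 1 := ⟨n - 1, by lia⟩
  simp only [Nat.add_sub_cancel]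
  refine ⟨⟨powerVectors (m + 1) d,
    le_antisymm (orthantCount_le _) (le_orthantCount_powerVectors m d)⟩,
    orthantCount_le, ?_, fun h => ?_⟩
  · rintro rfl
    simp
  · rw [pow_succ', ← Nat.sum_range_choose m]
    congr 1
    refine (Finset.sum_subset (Finset.range_mono h) fun i _ hi => ?_).symm
    exact Nat.choose_eq_zero_of_lt (by simpa using hi)
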